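/- Let k ≥ 3 be an integer. Suppose there exist a real polynomial P_{k−1} of degree at most k − 2 with leading coefficient 1/(k−2)! and a constant λ_{k−1} > 0 such that for all real y ≥ 2: |T_{k−1}(y) − y·P_{k−1}(log y)| ≤ λ_{k−1} · y^{(k−2)/(k−1)} · (log y)^{(k−2)(k−3)/(2(k−1))}. Set c = [((k−1)/(2k·λ_{k−1})) · (1/(k−1)! + 1)]^{(k−1)/k} and assume 0 < c < 2. Then there exist a real number x₀ > e and a real polynomial P_k of degree at most k − 1 with leading coefficient 1/(k−1)! such that, with λ_k = (1/c)·(1/(k−1)! + k) + k³·λ_{k−1}·c^{1/(k−1)}/(log x₀)^{(k−1)/k}, one has for all real x ≥ x₀: |T_k(x) − x·P_k(log x)| < λ_k · x^{(k−1)/k} · (log x)^{(k−1)(k−2)/(2k)}. -/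

import Mathlib

open Finset Real

/-- `dk k n` is the number of ways to write `n` as an ordered product of `k`
positive integers (the `k`-fold Dirichlet convolution of the constant
function `1`). -/
noncomputable def dk (k n : ℕ) : ℕ := (ArithmeticFunction.zeta ^ k) n

/-- `Tk k x = ∑_{n ≤ x} d_k(n)`. -/
noncomputable def Tk (k : ℕ) (x : ℝ) : ℝ := ∑ n ∈ Finset.Icc 1 ⌊x⌋₊, (dk k n : ℝ)

theorem dk_zero_right (k : ℕ) : dk k 0 = 0 := by
  simp [dk]

theorem Tk_mono (k : ℕ) : Monotone (Tk k) := fun _ _ h =>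
  Finset.sum_le_sum_of_subset_of_nonneg
    (Finset.Icc_subset_Icc_right (Nat.floor_le_floor h)) fun _ _ _ => Nat.cast_nonneg _

theorem Tk_succ_eq_hyperbola (k : ℕ) (x : ℝ) (B : ℕ) (hB : 1 ≤ B) (hBx : (B : ℝ) ≤ x) :
    Tk (k + 1) x = ∑ b ∈ Icc 1 B, Tk k (x / b)
      + ∑ a ∈ Icc 1 ⌊x / B⌋₊, (dk k a : ℝ) * ((⌊x / a⌋₊ : ℝ) - B) := by
  have hBN : B ≤ ⌊x⌋₊ := Nat.le_floor hBx
  set f : ArithmeticFunction ℕ := ArithmeticFunction.zeta ^ k with hf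
  have key : ∑ n ∈ Ioc 0 ⌊x⌋₊, dk (k + 1) n
      = ∑ b ∈ Ioc 0 B, ∑ a ∈ Ioc 0 (⌊x⌋₊ / b), dk k a
        + ∑ a ∈ Ioc 0 (⌊x⌋₊ / B), dk k a * (⌊x⌋₊ / a - B) := by
    have h1 : ∑ n ∈ Ioc 0 ⌊x⌋₊, dk (k + 1) n
        = ∑ b ∈ Ioc 0 ⌊x⌋₊, ∑ a ∈ Ioc 0 (⌊x⌋₊ / b), dk k a := by
      have := ArithmeticFunction.sum_Ioc_mul_eq_sum_sum ArithmeticFunction.zeta f ⌊x⌋₊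
      rw [show ArithmeticFunction.zeta * f = ArithmeticFunction.zeta ^ (k + 1) by
        rw [hf, pow_succ']] at this
      refine this.trans (Finset.sum_congr rfl fun b hb => ?_)
      rw [ArithmeticFunction.zeta_apply_ne (by simp at hb; omega), one_mul]
      rfl
    rw [h1, ← Finset.Ioc_union_Ioc_eq_Ioc (Nat.zero_le B) hBN,
      Finset.sum_union (Finset.Ioc_disjoint_Ioc_of_le le_rfl)]
    congr 1
    rw [Finset.sum_comm' (t' := Ioc 0 (⌊x⌋₊ / B)) (s' := fun a => Ioc B (⌊x⌋₊ / a))]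
    · refine Finset.sum_congr rfl fun a _ => ?_
      simp [mul_comm]
    · intro b a
      simp only [Finset.mem_Ioc]
      constructor
      · rintro ⟨⟨h1, h2⟩, h3, h4⟩
        have h5 := (Nat.le_div_iff_mul_le (by omega)).1 h4
        refine ⟨⟨h1, (Nat.le_div_iff_mul_le h3).2 (by rwa [mul_comm])⟩, h3,
          (Nat.le_div_iff_mul_le (by omega)).2 (le_trans (Nat.mul_le_mul_left _ h1.le) h5)⟩
      · rintro ⟨⟨h1, h2⟩, h3, h4⟩
        have h5 := (Nat.le_div_iff_mul_le h3).1 h2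
        exact ⟨⟨h1, h2.trans (Nat.div_le_self _ _)⟩, h3,
          (Nat.le_div_iff_mul_le (by omega)).2 (by rwa [mul_comm])⟩
  have hI : ∀ n : ℕ, Icc 1 n = Ioc 0 n := fun n => by ext; simp; omega
  simp only [Tk, hI]
  have := congrArg (Nat.cast : ℕ → ℝ) key
  push_cast at this
  rw [this]
  simp only [Nat.floor_div_natCast]
  congr 1
  refine Finset.sum_congr rfl fun a ha => ?_
  rw [Nat.cast_sub]
  simp only [Finset.mem_Ioc] at ha
  have h5 := (Nat.le_div_iff_mul_le (by omega)).1 ha.2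
  exact (Nat.le_div_iff_mul_le ha.1).2 (by rwa [mul_comm])

theorem sum_dk_mul_eq_integral (k : ℕ) (A : ℝ) :
    ∑ a ∈ Icc 1 ⌊A⌋₊, (dk k a : ℝ) * ((a : ℝ)⁻¹ - A⁻¹) = ∫ t in Set.Ioc 1 A, Tk k t / t ^ 2 := by
  have hd : ∀ t ∈ Set.Icc 1 A, HasDerivAt (fun t : ℝ => t⁻¹) (-(t ^ 2)⁻¹) t := fun t ht =>
    hasDerivAt_inv (by have := ht.1; positivity)
  have hs : ∀ (n : ℕ) (g : ℕ → ℝ), ∑ a ∈ Icc 0 n, g a * (dk k a : ℝ)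
      = ∑ a ∈ Icc 1 n, g a * (dk k a : ℝ) := fun n g => by
    rw [Finset.Icc_eq_cons_Ioc (Nat.zero_le _), Finset.sum_cons, dk_zero_right]
    simp
    rfl
  have hs1 : ∀ t : ℝ, ∑ a ∈ Icc 0 ⌊t⌋₊, (dk k a : ℝ) = Tk k t := fun t => by
    simpa [Tk] using hs ⌊t⌋₊ 1
  have hint : MeasureTheory.IntegrableOn (deriv fun t : ℝ => t⁻¹) (Set.Icc 1 A) := by
    have hc : ContinuousOn (fun t : ℝ => -(t ^ 2)⁻¹) (Set.Icc 1 A) := by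
      refine (ContinuousOn.inv₀ (by fun_prop) fun t ht => ?_).neg
      have := ht.1
      positivity
    refine (hc.integrableOn_Icc).congr_fun (fun t ht => (hd t ht).deriv.symm) measurableSet_Icc
  have := sum_mul_eq_sub_integral_mul₀ (𝕜 := ℝ) (f := fun t => t⁻¹) (c := fun n => (dk k n : ℝ))
    (by simp [dk_zero_right]) A (fun t ht => (hd t ht).differentiableAt) hint
  simp only [hs1] at this
  rw [hs _ (fun a => (a : ℝ)⁻¹)] at this
  simp only [mul_sub, Finset.sum_sub_distrib, ← Finset.sum_mul]
  rw [Finset.sum_congr rfl fun a _ => mul_comm (dk k a : ℝ) (a : ℝ)⁻¹, this]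
  have h2 : ∫ t in Set.Ioc 1 A, deriv (fun t : ℝ => t⁻¹) t * Tk k t
      = - ∫ t in Set.Ioc 1 A, Tk k t / t ^ 2 := by
    rw [← MeasureTheory.integral_neg]
    refine MeasureTheory.setIntegral_congr_fun measurableSet_Ioc fun t ht => ?_
    rw [(hd t ⟨ht.1.le, ht.2⟩).deriv]
    ring
  rw [h2, Tk]
  ring

theorem sum_dk_floor_bounds (k : ℕ) {x : ℝ} (hx : 0 ≤ x) (A : ℝ) :
    0 ≤ ∑ a ∈ Icc 1 ⌊A⌋₊, (dk k a : ℝ) * (x / a - ⌊x / a⌋₊) ∧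
      ∑ a ∈ Icc 1 ⌊A⌋₊, (dk k a : ℝ) * (x / a - ⌊x / a⌋₊) ≤ Tk k A := by
  constructor
  · refine Finset.sum_nonneg fun a _ => mul_nonneg (Nat.cast_nonneg _) ?_
    exact sub_nonneg.2 (Nat.floor_le (by positivity))
  · refine Finset.sum_le_sum fun a _ => ?_
    have := Nat.lt_floor_add_one (x / a)
    exact mul_le_of_le_one_right (Nat.cast_nonneg _) (by linarith)

theorem abs_trapezoid_sub_le {F f f' f'' : ℝ → ℝ} {a M : ℝ}
    (hF : ∀ t ∈ Set.Icc a (a + 1), HasDerivAt F (f t) t)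
    (hf : ∀ t ∈ Set.Icc a (a + 1), HasDerivAt f (f' t) t)
    (hf' : ∀ t ∈ Set.Icc a (a + 1), HasDerivAt f' (f'' t) t)
    (hM : ∀ t ∈ Set.Icc a (a + 1), |f'' t| ≤ M) :
    |(f a + f (a + 1)) / 2 - (F (a + 1) - F a)| ≤ M := by
  have hM0 : 0 ≤ M := (abs_nonneg _).trans (hM a ⟨le_rfl, by linarith⟩)
  have hlip : ∀ s ∈ Set.Icc a (a + 1), ∀ t ∈ Set.Icc a (a + 1), |f' t - f' s| ≤ M := by
    intro s hs t ht
    have := (convex_Icc a (a + 1)).norm_image_sub_le_of_norm_hasDerivWithin_le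
      (fun u hu => (hf' u hu).hasDerivWithinAt) (fun u hu => hM u hu) hs ht
    refine this.trans (mul_le_of_le_one_right hM0 ?_)
    rw [Real.norm_eq_abs, abs_le]
    constructor <;> linarith [hs.1, hs.2, ht.1, ht.2]
  set e : ℝ → ℝ := fun t => (t - a) * (f a + f t) / 2 - (F t - F a) with he
  have hde : ∀ t ∈ Set.Icc a (a + 1),
      HasDerivAt e ((1 * (f a + f t) + (t - a) * f' t) / 2 - f t) t := by
    intro t ht
    exact ((((hasDerivAt_id t).sub_const a).mul ((hf t ht).const_add (f a))).div_const 2).sub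
      ((hF t ht).sub_const (F a))
  have hbd : ∀ t ∈ Set.Icc a (a + 1),
      ‖(1 * (f a + f t) + (t - a) * f' t) / 2 - f t‖ ≤ M := by
    intro t ht
    have hsub : Set.Icc a t ⊆ Set.Icc a (a + 1) := Set.Icc_subset_Icc_right ht.2
    have := (convex_Icc a t).norm_image_sub_le_of_norm_hasDerivWithin_le
      (f := fun u => f u - f' t * u) (f' := fun u => f' u - f' t * 1) (C := M)
      (fun u hu => ((hf u (hsub hu)).sub ((hasDerivAt_id u).const_mul (f' t))).hasDerivWithinAt)
      (fun u hu => by simpa using hlip t ht u (hsub hu))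
      (Set.left_mem_Icc.2 ht.1) (Set.right_mem_Icc.2 ht.1)
    simp only [Real.norm_eq_abs] at this ⊢
    rw [abs_of_nonneg (a := t - a) (by linarith [ht.1])] at this
    have h1 : M * (t - a) ≤ M := mul_le_of_le_one_right hM0 (by linarith [ht.2])
    rw [abs_le] at this ⊢
    constructor <;> linarith [this.1, this.2]
  have := (convex_Icc a (a + 1)).norm_image_sub_le_of_norm_hasDerivWithin_le
    (fun u hu => (hde u hu).hasDerivWithinAt) hbd
    (Set.left_mem_Icc.2 (by linarith)) (Set.right_mem_Icc.2 (by linarith))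
  simpa [he] using this

theorem exists_abs_eval_le (p : Polynomial ℝ) {d : ℕ} (hd : p.natDegree ≤ d) :
    ∃ C : ℝ, 0 ≤ C ∧ ∀ L : ℝ, 1 ≤ L → |p.eval L| ≤ C * L ^ d := by
  refine ⟨∑ i ∈ range (d + 1), |p.coeff i|, Finset.sum_nonneg fun _ _ => abs_nonneg _,
    fun L hL => ?_⟩
  rw [p.eval_eq_sum_range' (Nat.lt_succ_of_le hd), Finset.sum_mul]
  refine (Finset.abs_sum_le_sum_abs _ _).trans (Finset.sum_le_sum fun i hi => ?_)
  rw [abs_mul, abs_of_nonneg (pow_nonneg (by linarith) i : 0 ≤ L ^ i)]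
  exact mul_le_mul_of_nonneg_left
    (pow_le_pow_right₀ hL (Nat.lt_succ_iff.1 (Finset.mem_range.1 hi))) (abs_nonneg _)

theorem exists_abs_eval_log_le (p : Polynomial ℝ) :
    ∃ C : ℝ, 0 ≤ C ∧ ∀ t : ℝ, 1 ≤ t → |p.eval (log t)| ≤ C * t ^ (1 / 2 : ℝ) := by
  obtain ⟨C, hC, h⟩ := exists_abs_eval_le (p.comp (Polynomial.X - Polynomial.C 1)) le_rfl
  set d := (p.comp (Polynomial.X - Polynomial.C 1)).natDegree
  set δ : ℝ := 1 / (2 * (d + 1)) with hδ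
  have hδ0 : 0 < δ := by positivity
  refine ⟨C * (1 + 1 / δ) ^ d, by positivity, fun t ht => ?_⟩
  have h1 := h (log t + 1) (by linarith [log_nonneg ht])
  simp only [Polynomial.eval_comp, Polynomial.eval_sub, Polynomial.eval_X, Polynomial.eval_C,
    add_sub_cancel_right] at h1
  refine h1.trans ?_
  rw [mul_assoc]
  refine mul_le_mul_of_nonneg_left ?_ hC
  have h2 : log t + 1 ≤ (1 + 1 / δ) * t ^ δ := by
    have h3 := log_le_rpow_div (by linarith : 0 ≤ t) hδ0
    have h4 : 1 ≤ t ^ δ := one_le_rpow ht hδ0.le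
    have : t ^ δ / δ = 1 / δ * t ^ δ := by ring
    linarith
  calc (log t + 1) ^ d ≤ ((1 + 1 / δ) * t ^ δ) ^ d :=
        pow_le_pow_left₀ (by linarith [log_nonneg ht]) h2 d
    _ = (1 + 1 / δ) ^ d * t ^ (δ * d) := by
        rw [mul_pow, ← rpow_natCast (t ^ δ), ← rpow_mul (by linarith)]
    _ ≤ (1 + 1 / δ) ^ d * t ^ (1 / 2 : ℝ) := by
        refine mul_le_mul_of_nonneg_left (rpow_le_rpow_of_exponent_le ht ?_) (by positivity)
        rw [hδ, div_mul_eq_mul_div, one_mul, div_le_div_iff₀ (by positivity) (by norm_num)]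
        linarith

theorem exists_limit_of_abs_sub_le {u r : ℕ → ℝ}
    (h : ∀ n, 1 ≤ n → |u (n + 1) - u n| ≤ r n - r (n + 1))
    (hr0 : ∀ n, 0 ≤ r n) :
    ∃ γ : ℝ, ∀ n, 1 ≤ n → |u n - γ| ≤ r n := by
  have hmn : ∀ n, 1 ≤ n → ∀ j, |u (n + j) - u n| ≤ r n - r (n + j) := by
    intro n hn j
    induction j with
    | zero => simp
    | succ j ih =>
      have := h (n + j) (by omega)
      rw [abs_le] at *
      rw [← add_assoc]
      constructor <;> linarith [this.1, this.2, ih.1, ih.2]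
  have hbdd : BddBelow (Set.range fun n : ℕ => u (n + 1) + r (n + 1)) := by
    refine ⟨u 1 - r 1, ?_⟩
    rintro _ ⟨n, rfl⟩
    have := (abs_le.1 (hmn 1 le_rfl n)).1
    rw [add_comm 1 n] at this
    simp only
    linarith [hr0 (n + 1)]
  refine ⟨⨅ n : ℕ, (u (n + 1) + r (n + 1)), fun n hn => ?_⟩
  rw [abs_le]
  constructor
  · have := ciInf_le hbdd (n - 1)
    rw [Nat.sub_add_cancel hn] at this
    linarith
  · have : u n - r n ≤ ⨅ n : ℕ, (u (n + 1) + r (n + 1)) := by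
      refine le_ciInf fun m => ?_
      rcases le_total n (m + 1) with h1 | h1
      · obtain ⟨j, hj⟩ := Nat.exists_eq_add_of_le h1
        have := (abs_le.1 (hmn n hn j)).1
        rw [hj]
        linarith [hr0 (n + j)]
      · obtain ⟨j, hj⟩ := Nat.exists_eq_add_of_le h1
        have := (abs_le.1 (hmn (m + 1) (by omega) j)).2
        rw [hj]
        linarith [hr0 (m + 1 + j)]
    linarith

theorem exists_eulerMaclaurin_log (G : Polynomial ℝ) :
    ∃ γ C : ℝ, 0 ≤ C ∧ ∀ N : ℕ, 1 ≤ N →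
      |∑ b ∈ Icc 1 N, G.derivative.eval (log b) / b - G.eval (log N)
        - G.derivative.eval (log N) / (2 * N) - γ| ≤ C * (N : ℝ) ^ (-(3 / 2) : ℝ) := by
  set p := G.derivative with hp
  set p1 := p.derivative - p with hp1
  set p2 := p1.derivative - Polynomial.C 2 * p1 with hp2
  have hlog : ∀ (q : Polynomial ℝ) (t : ℝ), 0 < t →
      HasDerivAt (fun t => q.eval (log t)) (q.derivative.eval (log t) * t⁻¹) t := fun q t ht =>
    (q.hasDerivAt (log t)).comp t (hasDerivAt_log ht.ne')
  obtain ⟨C, hC, hCb⟩ := exists_abs_eval_log_le p2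
  have hstep : ∀ n : ℕ, 1 ≤ n →
      |(p.eval (log n) / n + p.eval (log (n + 1 : ℝ)) / (n + 1)) / 2
        - (G.eval (log (n + 1 : ℝ)) - G.eval (log n))| ≤ C * (n : ℝ) ^ (-(5 / 2) : ℝ) := by
    intro n hn
    have hn0 : (0 : ℝ) < n := by exact_mod_cast hn
    have hn1 : (1 : ℝ) ≤ n := by exact_mod_cast hn
    refine abs_trapezoid_sub_le (F := fun t => G.eval (log t)) (f := fun t => p.eval (log t) / t)
      (f' := fun t => p1.eval (log t) / t ^ 2) (f'' := fun t => p2.eval (log t) / t ^ 3)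
      ?_ ?_ ?_ ?_
    · intro t ht
      exact hlog G t (by linarith [ht.1])
    · intro t ht
      have ht0 : 0 < t := by linarith [ht.1]
      convert! (hlog p t ht0).div (hasDerivAt_id t) ht0.ne' using 1
      simp [hp1]
      field_simp
    · intro t ht
      have ht0 : 0 < t := by linarith [ht.1]
      convert! (hlog p1 t ht0).div (hasDerivAt_pow 2 t) (by positivity) using 1
      simp [hp2]
      field_simp
    · intro t ht
      have ht0 : 0 < t := by linarith [ht.1]
      rw [abs_div, abs_of_pos (by positivity : 0 < t ^ 3), div_le_iff₀ (by positivity)]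
      refine (hCb t (by linarith [ht.1])).trans ?_
      rw [mul_assoc]
      refine mul_le_mul_of_nonneg_left ?_ hC
      have h1 : t ^ (1 / 2 : ℝ) = t ^ (-(5 / 2) : ℝ) * t ^ 3 := by
        rw [← rpow_natCast t 3, ← rpow_add ht0]
        norm_num
      rw [h1]
      exact mul_le_mul_of_nonneg_right
        (rpow_le_rpow_of_nonpos hn0 ht.1 (by norm_num)) (by positivity)
  have hr : ∀ n : ℕ, 1 ≤ n → (n : ℝ) ^ (-(5 / 2) : ℝ)
      ≤ 8 * (n : ℝ) ^ (-(3 / 2) : ℝ) - 8 * ((n + 1 : ℕ) : ℝ) ^ (-(3 / 2) : ℝ) := by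
    intro n hn
    have hn1 : (1 : ℝ) ≤ n := by exact_mod_cast hn
    have hn0 : (0 : ℝ) < n := by linarith
    have e1 : (n : ℝ) ^ (-(3 / 2) : ℝ) = n ^ (-(5 / 2) : ℝ) * n := by
      rw [← rpow_add_one hn0.ne']
      norm_num
    have e2 : ((n + 1 : ℕ) : ℝ) ^ (-(3 / 2) : ℝ) ≤ n ^ (-(5 / 2) : ℝ) * (n ^ 2 / (n + 1)) := by
      push_cast
      calc ((n : ℝ) + 1) ^ (-(3 / 2) : ℝ)
          = ((n : ℝ) + 1) ^ (-(1 / 2) : ℝ) * ((n : ℝ) + 1)⁻¹ := by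
            rw [← rpow_neg_one, ← rpow_add (by linarith)]
            norm_num
        _ ≤ (n : ℝ) ^ (-(1 / 2) : ℝ) * ((n : ℝ) + 1)⁻¹ :=
            mul_le_mul_of_nonneg_right
              (rpow_le_rpow_of_nonpos hn0 (by linarith) (by norm_num)) (by positivity)
        _ = n ^ (-(5 / 2) : ℝ) * (n ^ 2 / (n + 1)) := by
            rw [div_eq_mul_inv ((n : ℝ) ^ 2), ← mul_assoc, ← rpow_natCast (n : ℝ) 2, ← rpow_add hn0]
            norm_num
    have e3 : 0 < (n : ℝ) ^ (-(5 / 2) : ℝ) := by positivity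
    have e4 : (1 : ℝ) ≤ 8 * n - 8 * (n ^ 2 / (n + 1)) := by
      have : 8 * (n : ℝ) - 8 * (n ^ 2 / (n + 1)) = 8 * (n / (n + 1)) := by
        field_simp
        ring
      rw [this, ← mul_div_assoc, le_div_iff₀ (by linarith)]
      linarith
    nlinarith [mul_le_mul_of_nonneg_left e4 e3.le]
  obtain ⟨γ, hγ⟩ := exists_limit_of_abs_sub_le
    (u := fun N : ℕ => ∑ b ∈ Icc 1 N, p.eval (log b) / b - G.eval (log N)
        - p.eval (log N) / (2 * N)) (r := fun n : ℕ => C * (8 * (n : ℝ) ^ (-(3 / 2) : ℝ)))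
    (fun n hn => by
      have h1 := hstep n hn
      have h2 := mul_le_mul_of_nonneg_left (hr n hn) hC
      rw [Finset.sum_Icc_succ_top (by omega)]
      rw [← mul_sub]
      refine (le_of_eq ?_).trans (h1.trans h2)
      congr 1
      push_cast
      have hn0 : (0 : ℝ) < n := by exact_mod_cast hn
      field_simp
      ring) (fun n => by positivity)
  exact ⟨γ, C * 8, by positivity, fun N hN => by simpa [mul_assoc] using hγ N hN⟩

theorem exists_eulerMaclaurin_shifted_log (R : Polynomial ℝ) {d : ℕ} (hR : R.natDegree ≤ d + 1) :
    ∃ (S : Polynomial ℝ) (C : ℝ), S.natDegree ≤ d ∧ 0 ≤ C ∧ ∀ L : ℝ, 1 ≤ L → ∀ N : ℕ, 1 ≤ N →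
      |∑ b ∈ Icc 1 N, R.derivative.eval (L - log b) / b - (R.eval L - R.eval (L - log N))
        - S.eval L - R.derivative.eval (L - log N) / (2 * N)|
        ≤ C * L ^ d * (N : ℝ) ^ (-(3 / 2) : ℝ) := by
  choose γ K hK hγ using fun i : ℕ => exists_eulerMaclaurin_log (Polynomial.X ^ i)
  set a : ℕ → Polynomial ℝ := fun i => Polynomial.C ((-1) ^ i) * Polynomial.hasseDeriv i R with ha
  have hexp : ∀ L ℓ : ℝ, R.eval (L - ℓ) = ∑ i ∈ range (d + 2), (a i).eval L * ℓ ^ i := by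
    intro L ℓ
    have h1 := Polynomial.taylor_eval L R (-ℓ)
    rw [neg_add_eq_sub] at h1
    rw [← h1, Polynomial.eval_eq_sum_range' (n := d + 2)
      (by rw [Polynomial.natDegree_taylor]; omega)]
    refine Finset.sum_congr rfl fun i _ => ?_
    rw [Polynomial.taylor_coeff, neg_pow]
    simp [ha]
    ring
  have hderiv : ∀ L ℓ : ℝ, R.derivative.eval (L - ℓ)
      = -∑ i ∈ range (d + 1), (a (i + 1)).eval L
        * (Polynomial.X ^ (i + 1) : Polynomial ℝ).derivative.eval ℓ := by
    intro L ℓ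
    have h1 : R.comp (Polynomial.C L - Polynomial.X)
        = ∑ i ∈ range (d + 2), Polynomial.C ((a i).eval L) * Polynomial.X ^ i := by
      refine Polynomial.funext fun t => ?_
      simp [Polynomial.eval_finsetSum, hexp]
    have h2 := congrArg (fun q => Polynomial.eval ℓ (Polynomial.derivative q)) h1
    simp only [Polynomial.derivative_comp, Polynomial.derivative_sub, Polynomial.derivative_C,
      Polynomial.derivative_X, Polynomial.eval_mul, Polynomial.eval_comp, Polynomial.eval_sub,
      Polynomial.eval_C, Polynomial.eval_X, Polynomial.eval_zero, Polynomial.eval_one,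
      Polynomial.derivative_sum, Polynomial.derivative_C_mul, Polynomial.eval_finsetSum] at h2
    rw [Finset.sum_range_succ'] at h2
    simp only [pow_zero, Polynomial.derivative_one, Polynomial.eval_zero, mul_zero, add_zero] at h2
    linarith
  have hadeg : ∀ i, (a (i + 1)).natDegree ≤ d := fun i =>
    (Polynomial.natDegree_C_mul_le _ _).trans
      ((Polynomial.natDegree_hasseDeriv_le R (i + 1)).trans (by omega))
  choose M hM hMb using fun i => exists_abs_eval_le (a (i + 1)) (hadeg i)
  refine ⟨-∑ i ∈ range (d + 1), Polynomial.C (γ (i + 1)) * a (i + 1),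
    ∑ i ∈ range (d + 1), M i * K (i + 1), ?_,
    Finset.sum_nonneg fun i _ => mul_nonneg (hM i) (hK _), ?_⟩
  · rw [Polynomial.natDegree_neg]
    exact Polynomial.natDegree_sum_le_of_forall_le _ _ fun i _ =>
      (Polynomial.natDegree_C_mul_le _ _).trans (hadeg i)
  intro L hL N hN
  have hid : ∑ b ∈ Icc 1 N, R.derivative.eval (L - log b) / b
        - (R.eval L - R.eval (L - log N))
        - (-∑ i ∈ range (d + 1), Polynomial.C (γ (i + 1)) * a (i + 1)).eval L
        - R.derivative.eval (L - log N) / (2 * N)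
      = -∑ i ∈ range (d + 1), (a (i + 1)).eval L *
        (∑ b ∈ Icc 1 N, (Polynomial.X ^ (i + 1) : Polynomial ℝ).derivative.eval (log b) / b
          - (Polynomial.X ^ (i + 1) : Polynomial ℝ).eval (log N)
          - (Polynomial.X ^ (i + 1) : Polynomial ℝ).derivative.eval (log N) / (2 * N)
          - γ (i + 1)) := by
    have h0 : R.eval L - R.eval (L - log N)
        = -∑ i ∈ range (d + 1), (a (i + 1)).eval L * log N ^ (i + 1) := by
      have h1 := hexp L 0
      have h2 := hexp L (log N)
      rw [Finset.sum_range_succ'] at h1 h2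
      simp at h1 h2
      linarith
    rw [h0]
    simp only [hderiv, mul_sub, Finset.sum_sub_distrib, Finset.mul_sum, neg_div,
      Finset.sum_neg_distrib, Finset.sum_div, Polynomial.eval_neg, Polynomial.eval_finsetSum,
      Polynomial.eval_mul, Polynomial.eval_C, Polynomial.eval_pow, Polynomial.eval_X]
    rw [Finset.sum_comm]
    simp only [mul_div_assoc, mul_comm (γ _)]
    ring
  rw [hid, abs_neg]
  refine (Finset.abs_sum_le_sum_abs _ _).trans ?_
  rw [Finset.sum_mul, Finset.sum_mul]
  refine Finset.sum_le_sum fun i _ => ?_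
  rw [abs_mul]
  calc _ ≤ (M i * L ^ d) * (K (i + 1) * (N : ℝ) ^ (-(3 / 2) : ℝ)) :=
        mul_le_mul (hMb i L hL) (hγ (i + 1) N hN) (abs_nonneg _)
          (mul_nonneg (hM i) (by positivity))
    _ = _ := by ring

theorem exists_antiderivative (P : Polynomial ℝ) {d : ℕ} (hP : P.natDegree ≤ d) :
    ∃ R : Polynomial ℝ, R.derivative = P ∧ R.eval 0 = 0 ∧ R.natDegree ≤ d + 1 ∧
      R.coeff (d + 1) = P.coeff d / (d + 1) := by
  refine ⟨∑ i ∈ range (d + 1), Polynomial.monomial (i + 1) (P.coeff i / (i + 1)), ?_, ?_, ?_, ?_⟩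
  · conv_rhs => rw [P.as_sum_range' (d + 1) (Nat.lt_succ_of_le hP)]
    rw [Polynomial.derivative_sum]
    refine Finset.sum_congr rfl fun i _ => ?_
    rw [Polynomial.derivative_monomial]
    push_cast
    rw [div_mul_cancel₀ _ (by positivity)]
  · simp [Polynomial.eval_finsetSum, Polynomial.eval_monomial]
  · exact Polynomial.natDegree_sum_le_of_forall_le _ _ fun i hi =>
      (Polynomial.natDegree_monomial_le _).trans (by simp at hi; omega)
  · simp [Polynomial.coeff_monomial]

theorem integral_eval_log_div (R : Polynomial ℝ) {A : ℝ} (hA : 1 ≤ A) :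
    MeasureTheory.IntegrableOn (fun t => R.derivative.eval (log t) / t) (Set.Ioc 1 A) ∧
      ∫ t in Set.Ioc 1 A, R.derivative.eval (log t) / t = R.eval (log A) - R.eval 0 := by
  have hc : ContinuousOn (fun t : ℝ => R.derivative.eval (log t) / t) (Set.Icc 1 A) := by
    refine ContinuousOn.div (R.derivative.continuous.comp_continuousOn
      (continuousOn_log.mono fun t ht => ?_)) continuousOn_id fun t ht => ?_
    · simp; linarith [ht.1]
    · simp; linarith [ht.1]
  refine ⟨hc.integrableOn_Icc.mono_set Set.Ioc_subset_Icc_self, ?_⟩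
  rw [← intervalIntegral.integral_of_le hA,
    intervalIntegral.integral_eq_sub_of_hasDerivAt (f := fun t => R.eval (log t)), log_one]
  · intro t ht
    rw [Set.uIcc_of_le hA] at ht
    have ht0 : t ≠ 0 := by linarith [ht.1]
    rw [div_eq_mul_inv]
    exact (R.hasDerivAt (log t)).comp t (hasDerivAt_log ht0)
  · exact ContinuousOn.intervalIntegrable (by rwa [Set.uIcc_of_le hA])

theorem exists_abs_Tk_succ_sub_le (k d : ℕ) (P : Polynomial ℝ) (hP : P.natDegree ≤ d)
    (hint : MeasureTheory.IntegrableOn (fun t => (Tk k t - t * P.eval (log t)) / t ^ 2)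
      (Set.Ioi 1)) :
    ∃ (Q : Polynomial ℝ) (C : ℝ), Q.natDegree ≤ d + 1 ∧ Q.coeff (d + 1) = P.coeff d / (d + 1) ∧
      0 ≤ C ∧ ∀ (x : ℝ) (B : ℕ), 1 ≤ B → (B : ℝ) ≤ x → 1 ≤ log x →
        |Tk (k + 1) x - x * Q.eval (log x)|
          ≤ x / B * |P.eval (log (x / B))| / 2
            + |Tk k (x / B) - x / B * P.eval (log (x / B))|
            + x * (C * log x ^ d * (B : ℝ) ^ (-(3 / 2) : ℝ))
            + ∑ b ∈ Icc 1 B, |Tk k (x / b) - x / b * P.eval (log (x / b))|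
            + x * ∫ t in Set.Ioi (x / B), |Tk k t - t * P.eval (log t)| / t ^ 2 := by
  obtain ⟨R, hRd, hR0, hRdeg, hRc⟩ := exists_antiderivative P hP
  obtain ⟨S, C, hS, hC, hE⟩ := exists_eulerMaclaurin_shifted_log R hRdeg
  rw [hRd] at hE
  set Δ : ℝ → ℝ := fun t => Tk k t - t * P.eval (log t) with hΔ
  set C₀ : ℝ := ∫ t in Set.Ioi 1, Δ t / t ^ 2 with hC₀
  refine ⟨R + (S + Polynomial.C C₀), C, ?_, ?_, hC, ?_⟩
  · refine Polynomial.natDegree_add_le_of_degree_le hRdeg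
      ((Polynomial.natDegree_add_le_of_degree_le (n := d) hS (by simp)).trans (by omega))
  · have h1 : (S + Polynomial.C C₀).coeff (d + 1) = 0 :=
      Polynomial.coeff_eq_zero_of_natDegree_lt
        (Nat.lt_succ_of_le (Polynomial.natDegree_add_le_of_degree_le (n := d) hS (by simp)))
    rw [Polynomial.coeff_add, h1, add_zero, hRc]
  intro x B hB hBx hL
  have hB0 : (0 : ℝ) < B := by exact_mod_cast hB
  have hx0 : 0 < x := by linarith
  set A := x / B with hAdef
  have hA : 1 ≤ A := (one_le_div hB0).2 hBx
  have hE' := hE (log x) hL B hB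
  set E := ∑ b ∈ Icc 1 B, P.eval (log x - log b) / b - (R.eval (log x) - R.eval (log x - log B))
        - S.eval (log x) - P.eval (log x - log B) / (2 * B) with hEdef
  have hlogA : log x - log B = log A := (log_div hx0.ne' hB0.ne').symm
  obtain ⟨hf0, hfT⟩ := sum_dk_floor_bounds k hx0.le A
  set F := ∑ a ∈ Icc 1 ⌊A⌋₊, (dk k a : ℝ) * (x / a - ⌊x / a⌋₊) with hF
  set I := ∫ t in Set.Ioi A, Δ t / t ^ 2 with hI
  have hsum1 : ∑ b ∈ Icc 1 B, Tk k (x / b)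
      = x * ∑ b ∈ Icc 1 B, P.eval (log x - log b) / b + ∑ b ∈ Icc 1 B, Δ (x / b) := by
    rw [Finset.mul_sum, ← Finset.sum_add_distrib]
    refine Finset.sum_congr rfl fun b hb => ?_
    have hb0 : (0 : ℝ) < b := by simp at hb; exact_mod_cast hb.1
    simp only [hΔ]
    rw [log_div hx0.ne' hb0.ne']
    ring
  have hint2 : ∫ t in Set.Ioc 1 A, Tk k t / t ^ 2 = R.eval (log A) + (C₀ - I) := by
    obtain ⟨hi1, hi2⟩ := integral_eval_log_div R hA
    rw [hRd] at hi1 hi2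
    have hi3 : MeasureTheory.IntegrableOn (fun t => Δ t / t ^ 2) (Set.Ioc 1 A) :=
      hint.mono_set Set.Ioc_subset_Ioi_self
    have h1 : C₀ - I = ∫ t in Set.Ioc 1 A, Δ t / t ^ 2 := by
      rw [hC₀, hI, ← Set.Ioc_union_Ioi_eq_Ioi hA, MeasureTheory.setIntegral_union
        (Set.Ioc_disjoint_Ioi le_rfl) measurableSet_Ioi hi3
        (hint.mono_set (Set.Ioi_subset_Ioi hA))]
      ring
    rw [h1, ← sub_zero (R.eval (log A)), ← hR0, ← hi2, ← MeasureTheory.integral_add hi1 hi3]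
    refine MeasureTheory.setIntegral_congr_fun measurableSet_Ioc fun t ht => ?_
    have ht0 : t ≠ 0 := by linarith [ht.1]
    simp only [hΔ]
    field_simp
    ring
  have hsum2 : ∑ a ∈ Icc 1 ⌊A⌋₊, (dk k a : ℝ) * ((⌊x / a⌋₊ : ℝ) - B)
      = x * (R.eval (log A) + (C₀ - I)) - F := by
    rw [← hint2, ← sum_dk_mul_eq_integral, Finset.mul_sum, hF, ← Finset.sum_sub_distrib]
    refine Finset.sum_congr rfl fun a _ => ?_
    have : x * A⁻¹ = B := by
      rw [hAdef]
      field_simp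
    rw [← this]
    ring
  have hmain : Tk (k + 1) x - x * (R + (S + Polynomial.C C₀)).eval (log x)
      = (A * P.eval (log A) / 2 - F) + x * E + ∑ b ∈ Icc 1 B, Δ (x / b) - x * I := by
    rw [Tk_succ_eq_hyperbola k x B hB hBx, hsum1, hsum2, hEdef, hlogA]
    simp only [Polynomial.eval_add, Polynomial.eval_C]
    rw [hAdef]
    field_simp
    ring
  have hI' : |I| ≤ ∫ t in Set.Ioi A, |Δ t| / t ^ 2 := by
    refine (MeasureTheory.abs_integral_le_integral_abs).trans (le_of_eq ?_)
    refine MeasureTheory.setIntegral_congr_fun measurableSet_Ioi fun t ht => ?_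
    simp only [abs_div, abs_pow, sq_abs]
  have h1 : |A * P.eval (log A) / 2 - F| ≤ A * |P.eval (log A)| / 2 + |Δ A| := by
    have hT : Tk k A = A * P.eval (log A) + Δ A := by simp [hΔ]
    rw [hT] at hfT
    have h2 : |A * P.eval (log A)| = A * |P.eval (log A)| := by
      rw [abs_mul, abs_of_nonneg (by linarith)]
    rw [← h2, abs_le]
    constructor <;>
      linarith [le_abs_self (A * P.eval (log A)), neg_abs_le (A * P.eval (log A)),
        le_abs_self (Δ A), neg_abs_le (Δ A)]
  have h3 : |x * E| ≤ x * (C * log x ^ d * (B : ℝ) ^ (-(3 / 2) : ℝ)) := by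
    rw [abs_mul, abs_of_pos hx0]
    exact mul_le_mul_of_nonneg_left hE' hx0.le
  have h4 : |∑ b ∈ Icc 1 B, Δ (x / b)| ≤ ∑ b ∈ Icc 1 B, |Δ (x / b)| :=
    Finset.abs_sum_le_sum_abs _ _
  have h5 : |x * I| ≤ x * ∫ t in Set.Ioi A, |Δ t| / t ^ 2 := by
    rw [abs_mul, abs_of_pos hx0]
    exact mul_le_mul_of_nonneg_left hI' hx0.le
  rw [hmain]
  refine (abs_sub _ _).trans (add_le_add ?_ h5)
  refine (abs_add_le _ _).trans (add_le_add ?_ h4)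
  exact (abs_add_le _ _).trans (add_le_add h1 h3)

theorem sum_rpow_sub_one_le {s : ℝ} (hs0 : 0 < s) (hs1 : s ≤ 1) (B : ℕ) :
    ∑ b ∈ Icc 1 B, (b : ℝ) ^ (s - 1) ≤ (B : ℝ) ^ s / s := by
  induction B with
  | zero => simp [zero_rpow hs0.ne']
  | succ n ih =>
    rw [Finset.sum_Icc_succ_top (by omega)]
    push_cast
    have hn : (0 : ℝ) < n + 1 := by positivity
    have h1 : (n : ℝ) ^ s ≤ ((n : ℝ) + 1) ^ s - s * ((n : ℝ) + 1) ^ (s - 1) := by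
      have h2 : (1 + -(1 / ((n : ℝ) + 1))) ^ s ≤ 1 + s * -(1 / ((n : ℝ) + 1)) := by
        refine rpow_one_add_le_one_add_mul_self ?_ hs0.le hs1
        rw [neg_le_neg_iff, div_le_one hn]
        linarith [(Nat.cast_nonneg n : (0 : ℝ) ≤ n)]
      have h3 : (n : ℝ) = (n + 1) * (1 + -(1 / ((n : ℝ) + 1))) := by
        field_simp
        ring
      have h4 : 0 ≤ 1 + -(1 / ((n : ℝ) + 1)) := by
        have : 1 + -(1 / ((n : ℝ) + 1)) = n / (n + 1) := by
          field_simp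
          ring
        rw [this]
        positivity
      calc (n : ℝ) ^ s = ((n : ℝ) + 1) ^ s * (1 + -(1 / ((n : ℝ) + 1))) ^ s := by
            conv_lhs => rw [h3]
            rw [mul_rpow hn.le h4]
        _ ≤ ((n : ℝ) + 1) ^ s * (1 + s * -(1 / ((n : ℝ) + 1))) :=
            mul_le_mul_of_nonneg_left h2 (by positivity)
        _ = ((n : ℝ) + 1) ^ s - s * ((n : ℝ) + 1) ^ (s - 1) := by
            rw [rpow_sub_one hn.ne']
            ring
    have h5 : (n : ℝ) ^ s / s ≤ ((n : ℝ) + 1) ^ s / s - ((n : ℝ) + 1) ^ (s - 1) := by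
      rw [div_le_iff₀ hs0, sub_mul, div_mul_cancel₀ _ hs0.ne']
      linarith
    linarith

theorem exists_integral_Ioi_abs_div_sq_le {Δ : ℝ → ℝ} (hΔ : Measurable Δ) {lam s e η : ℝ}
    (hs : 0 < s) (he : 0 ≤ e) (hη : 0 < η)
    (hb : ∀ y, 2 ≤ y → |Δ y| ≤ lam * y ^ (1 - s) * log y ^ e) :
    ∃ T : ℝ, 2 ≤ T ∧ ∀ A, T ≤ A →
      MeasureTheory.IntegrableOn (fun t => Δ t / t ^ 2) (Set.Ioi A) ∧
      ∫ t in Set.Ioi A, |Δ t| / t ^ 2 ≤ (1 + η) / s * (lam * log A ^ e * A ^ (-s)) := by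
  have hlam : 0 ≤ lam := by
    have h1 := (abs_nonneg _).trans (hb 2 le_rfl)
    rw [mul_assoc] at h1
    have h2 : 0 < (2 : ℝ) ^ (1 - s) * log 2 ^ e := by
      have := log_pos one_lt_two
      positivity
    exact nonneg_of_mul_nonneg_left h1 h2
  set δ := s * η / (1 + η) with hδ
  have hδ0 : 0 < δ := by positivity
  have hsδ : s - δ = s / (1 + η) := by
    rw [hδ]
    field_simp
    ring
  have hsδ0 : 0 < s - δ := by rw [hsδ]; positivity
  set a := δ / (e + 1) with ha
  have ha0 : 0 < a := by positivity
  have hae : a * e ≤ δ := by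
    rw [ha, div_mul_eq_mul_div, div_le_iff₀ (by positivity)]
    nlinarith
  refine ⟨max 2 (exp (1 / a)), le_max_left _ _, fun A hA => ?_⟩
  have hA2 : 2 ≤ A := (le_max_left _ _).trans hA
  have hAe : exp (1 / a) ≤ A := (le_max_right _ _).trans hA
  have hA0 : 0 < A := by linarith
  set K := lam * log A ^ e * A ^ (-δ) with hK
  have hlogA : 0 < log A := log_pos (by linarith)
  have hbound : ∀ t ∈ Set.Ioi A, |Δ t| / t ^ 2 ≤ K * t ^ (-(1 + (s - δ))) := by
    intro t ht
    have ht' : A < t := ht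
    have ht0 : 0 < t := by linarith
    have hlt : 0 < log t := log_pos (by linarith)
    have h1 : log t ≤ log A * (t / A) ^ a := by
      have h2 := log_div_self_rpow_antitoneOn ha0
        (Set.mem_Ici.2 (by simpa using hAe))
        (Set.mem_Ici.2 (by simpa using hAe.trans ht'.le)) ht'.le
      simp only at h2
      rw [div_le_iff₀ (by positivity)] at h2
      rw [div_rpow ht0.le hA0.le]
      refine h2.trans (le_of_eq (by ring))
    have h3 : log t ^ e ≤ log A ^ e * (t / A) ^ δ := by
      refine (rpow_le_rpow hlt.le h1 he).trans ?_
      rw [mul_rpow hlogA.le (by positivity), ← rpow_mul (by positivity)]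
      refine mul_le_mul_of_nonneg_left ?_ (by positivity)
      exact rpow_le_rpow_of_exponent_le ((one_le_div hA0).2 ht'.le) hae
    rw [div_le_iff₀ (by positivity)]
    refine (hb t (by linarith)).trans ?_
    refine (mul_le_mul_of_nonneg_left h3 (by positivity)).trans (le_of_eq ?_)
    rw [hK, div_rpow ht0.le hA0.le, rpow_neg hA0.le]
    have h4 : t ^ (1 - s) * t ^ δ = t ^ (-(1 + (s - δ))) * t ^ 2 := by
      rw [← rpow_natCast t 2, ← rpow_add ht0, ← rpow_add ht0]
      congr 1
      push_cast
      ring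
    calc lam * t ^ (1 - s) * (log A ^ e * (t ^ δ / A ^ δ))
        = lam * log A ^ e * (A ^ δ)⁻¹ * (t ^ (1 - s) * t ^ δ) := by ring
      _ = _ := by rw [h4]; ring
  have hlt : -(1 + (s - δ)) < -1 := by linarith
  have hint : MeasureTheory.IntegrableOn (fun t => K * t ^ (-(1 + (s - δ)))) (Set.Ioi A) :=
    (integrableOn_Ioi_rpow_of_lt hlt hA0).const_mul K
  have hintΔ : MeasureTheory.IntegrableOn (fun t => Δ t / t ^ 2) (Set.Ioi A) := by
    refine MeasureTheory.Integrable.mono' hint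
      (hΔ.div (measurable_id.pow_const 2)).aestronglyMeasurable ?_
    refine (MeasureTheory.ae_restrict_mem measurableSet_Ioi).mono fun t ht => ?_
    rw [Real.norm_eq_abs, abs_div, abs_of_nonneg (sq_nonneg t)]
    exact hbound t ht
  refine ⟨hintΔ, ?_⟩
  have h1 : MeasureTheory.IntegrableOn (fun t => |Δ t| / t ^ 2) (Set.Ioi A) :=
    hintΔ.abs.congr (Filter.Eventually.of_forall fun t => by simp [abs_div])
  refine (MeasureTheory.setIntegral_mono_on h1 hint measurableSet_Ioi hbound).trans
    (le_of_eq ?_)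
  rw [MeasureTheory.integral_const_mul, integral_Ioi_rpow_of_lt hlt hA0]
  have h2 : -(1 + (s - δ)) + 1 = -(s - δ) := by ring
  have h3 : A ^ (-s) = A ^ (-δ) * A ^ (-(s - δ)) := by
    rw [← rpow_add hA0]
    congr 1
    ring
  rw [h2, neg_div_neg_eq, h3, hK, hsδ]
  field_simp

theorem integrableOn_Tk_sub_div_sq (k : ℕ) (P : Polynomial ℝ) {T : ℝ} (hT : 1 ≤ T)
    (h : MeasureTheory.IntegrableOn (fun t => (Tk k t - t * P.eval (log t)) / t ^ 2)
      (Set.Ioi T)) :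
    MeasureTheory.IntegrableOn (fun t => (Tk k t - t * P.eval (log t)) / t ^ 2) (Set.Ioi 1) := by
  rw [← Set.Ioc_union_Ioi_eq_Ioi hT]
  refine MeasureTheory.IntegrableOn.union ?_ h
  refine MeasureTheory.IntegrableOn.mono_set ?_ Set.Ioc_subset_Icc_self
  have h1 : MeasureTheory.IntegrableOn (Tk k) (Set.Icc 1 T) :=
    ((Tk_mono k).monotoneOn _).integrableOn_isCompact isCompact_Icc
  have hlog : ContinuousOn (fun t : ℝ => t * P.eval (log t)) (Set.Icc 1 T) :=
    continuousOn_id.mul (P.continuous.comp_continuousOn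
      (continuousOn_log.mono fun t ht => by simp; linarith [ht.1]))
  have hinv : ContinuousOn (fun t : ℝ => (t ^ 2)⁻¹) (Set.Icc 1 T) :=
    ContinuousOn.inv₀ (by fun_prop) fun t ht => by
      have := ht.1
      positivity
  exact (h1.sub hlog.integrableOn_Icc).mul_continuousOn hinv isCompact_Icc

theorem eventually_abs_eval_le (P : Polynomial ℝ) {d : ℕ} (hP : P.natDegree ≤ d)
    (hpos : 0 < P.coeff d) {η : ℝ} (hη : 0 < η) :
    ∀ᶠ u : ℝ in Filter.atTop, |P.eval u| ≤ (1 + η) * P.coeff d * u ^ d := by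
  have hd : P.natDegree = d :=
    le_antisymm hP (Polynomial.le_natDegree_of_ne_zero hpos.ne')
  have h1 := (Polynomial.isEquivalent_atTop_lead P).isLittleO.def hη
  filter_upwards [h1, Filter.eventually_ge_atTop 0] with u hu hu0
  have h2 : 0 ≤ P.coeff d * u ^ d := by positivity
  simp only [Pi.sub_apply, Polynomial.leadingCoeff, hd, Real.norm_eq_abs] at hu
  rw [abs_of_nonneg h2] at hu
  calc |P.eval u| = |(P.eval u - P.coeff d * u ^ d) + P.coeff d * u ^ d| := by
        rw [sub_add_cancel]
    _ ≤ η * (P.coeff d * u ^ d) + P.coeff d * u ^ d :=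
        (abs_add_le _ _).trans (add_le_add hu (abs_of_nonneg h2).le)
    _ = _ := by ring

theorem exists_eventually_abs_Tk_succ_sub_le (k d : ℕ) (P : Polynomial ℝ)
    (hP : P.natDegree ≤ d) (hpos : 0 < P.coeff d) {lam s e : ℝ} (hlam : 0 ≤ lam) (hs0 : 0 < s)
    (hs1 : s ≤ 1) (he : 0 ≤ e)
    (hb : ∀ y : ℝ, 2 ≤ y →
      |Tk k y - y * P.eval (log y)| ≤ lam * y ^ (1 - s) * log y ^ e)
    {H : ℝ → ℝ} (hH : Filter.Tendsto H Filter.atTop Filter.atTop)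
    (hxH : Filter.Tendsto (fun x => x / H x) Filter.atTop Filter.atTop) :
    ∃ Q : Polynomial ℝ, Q.natDegree ≤ d + 1 ∧ Q.coeff (d + 1) = P.coeff d / (d + 1) ∧
      ∀ η : ℝ, 0 < η → ∀ᶠ x : ℝ in Filter.atTop,
        |Tk (k + 1) x - x * Q.eval (log x)|
          ≤ ((1 + η) ^ 2 * P.coeff d / 2 + η) * (x / H x * log x ^ d)
            + (η + 1 / s + (1 + η) / s) * (lam * (x ^ (1 - s) * log x ^ e * H x ^ s)) := by
  set Δ : ℝ → ℝ := fun t => Tk k t - t * P.eval (log t) with hΔ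
  have hmeas : Measurable Δ :=
    (Tk_mono k).measurable.sub
      (measurable_id.mul (P.continuous.measurable.comp measurable_log))
  have hint : MeasureTheory.IntegrableOn (fun t => Δ t / t ^ 2) (Set.Ioi 1) := by
    obtain ⟨T, hT, h⟩ := exists_integral_Ioi_abs_div_sq_le hmeas hs0 he one_pos hb
    exact integrableOn_Tk_sub_div_sq k P (by linarith) (h T le_rfl).1
  obtain ⟨Q, C, hQ, hQc, hC, hmain⟩ := exists_abs_Tk_succ_sub_le k d P hP hint
  refine ⟨Q, hQ, hQc, fun η hη => ?_⟩
  obtain ⟨T, hT, htail⟩ := exists_integral_Ioi_abs_div_sq_le hmeas hs0 he hη hb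
  have hfloor : Filter.Tendsto (fun x => ⌊H x⌋₊) Filter.atTop Filter.atTop :=
    tendsto_nat_floor_atTop.comp hH
  have hsmall : ∀ᶠ n : ℕ in Filter.atTop, C * (1 + η) * (n : ℝ) ^ (-(1 / 2) : ℝ) ≤ η := by
    have h1 : Filter.Tendsto (fun n : ℕ => C * (1 + η) * (n : ℝ) ^ (-(1 / 2) : ℝ))
        Filter.atTop (nhds (C * (1 + η) * 0)) :=
      ((tendsto_rpow_neg_atTop (by norm_num)).comp tendsto_natCast_atTop_atTop).const_mul _
    rw [mul_zero] at h1
    exact h1.eventually_le_const hη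
  have hHs : ∀ᶠ x in Filter.atTop, 1 / η ≤ H x ^ s :=
    ((tendsto_rpow_atTop hs0).comp hH).eventually_ge_atTop _
  obtain ⟨u₀, hu₀⟩ := Filter.eventually_atTop.1 (eventually_abs_eval_le P hP hpos hη)
  filter_upwards [hH.eventually_ge_atTop (1 + 1 / η), hxH.eventually_ge_atTop T,
    hfloor.eventually hsmall, hHs, hxH.eventually_ge_atTop (exp u₀),
    tendsto_log_atTop.eventually_ge_atTop 1, Filter.eventually_gt_atTop 0]
    with x h1 h2 h3 h4 h5 h6 hx0
  have hη' : 0 < 1 / η := by positivity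
  have hH0 : 0 < H x := by linarith
  set B := ⌊H x⌋₊ with hB
  have hB1 : 1 ≤ B := Nat.le_floor (by push_cast; linarith)
  have hB1' : (1 : ℝ) ≤ B := by exact_mod_cast hB1
  have hB0 : (0 : ℝ) < B := by linarith
  have hBH : (B : ℝ) ≤ H x := Nat.floor_le hH0.le
  have hHB : H x ≤ (1 + η) * B := by
    have h7 : H x - 1 ≤ B := by linarith [Nat.lt_floor_add_one (H x)]
    have h8 : η * (1 + 1 / η) ≤ η * H x := mul_le_mul_of_nonneg_left h1 hη.le
    have h9 : η * (1 + 1 / η) = η + 1 := by field_simp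
    nlinarith
  set A := x / B with hA
  have hAH : x / H x ≤ A := div_le_div_of_nonneg_left hx0.le hB0 hBH
  have hAle : A ≤ (1 + η) * (x / H x) := by
    rw [hA, div_le_iff₀ hB0]
    calc x = x / H x * H x := (div_mul_cancel₀ x hH0.ne').symm
      _ ≤ x / H x * ((1 + η) * B) := mul_le_mul_of_nonneg_left hHB (by positivity)
      _ = _ := by ring
  have hTA : T ≤ A := h2.trans hAH
  have hA2 : 2 ≤ A := hT.trans hTA
  have hA0 : 0 < A := by linarith
  have hBx : (B : ℝ) ≤ x := by
    have := (le_div_iff₀ hB0).1 hA2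
    linarith
  have hAx : A ≤ x := div_le_self hx0.le hB1'
  have hlogA0 : 0 ≤ log A := log_nonneg (by linarith)
  have hlogAx : log A ≤ log x := log_le_log hA0 hAx
  have hL0 : 0 < log x := by linarith
  set V := x ^ (1 - s) * log x ^ e with hV
  have hV0 : 0 ≤ V := by positivity
  have hT1 : A * |P.eval (log A)| / 2
      ≤ (1 + η) ^ 2 * P.coeff d / 2 * (x / H x * log x ^ d) := by
    have h7 : u₀ ≤ log A := (le_log_iff_exp_le hA0).2 (h5.trans hAH)
    have h8 : |P.eval (log A)| ≤ (1 + η) * P.coeff d * log x ^ d :=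
      (hu₀ _ h7).trans (mul_le_mul_of_nonneg_left (pow_le_pow_left₀ hlogA0 hlogAx d)
        (by positivity))
    have h9 := mul_le_mul hAle h8 (abs_nonneg _) (by positivity)
    calc A * |P.eval (log A)| / 2
        ≤ (1 + η) * (x / H x) * ((1 + η) * P.coeff d * log x ^ d) / 2 := by linarith
      _ = _ := by ring
  have hT2 : |Δ A| ≤ η * (lam * (V * H x ^ s)) := by
    calc |Δ A| ≤ lam * A ^ (1 - s) * log A ^ e := hb A hA2
      _ ≤ lam * x ^ (1 - s) * log x ^ e := by
        gcongr
      _ = η * (lam * V) * (1 / η) := by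
        rw [hV]
        field_simp
      _ ≤ η * (lam * V) * H x ^ s := mul_le_mul_of_nonneg_left h4 (by positivity)
      _ = _ := by ring
  have hT3 : x * (C * log x ^ d * (B : ℝ) ^ (-(3 / 2) : ℝ)) ≤ η * (x / H x * log x ^ d) := by
    have h7 : (B : ℝ) ^ (-(3 / 2) : ℝ) = (B : ℝ) ^ (-(1 / 2) : ℝ) / B := by
      rw [← rpow_sub_one hB0.ne']
      norm_num
    calc x * (C * log x ^ d * (B : ℝ) ^ (-(3 / 2) : ℝ))
        = A * (C * (B : ℝ) ^ (-(1 / 2) : ℝ)) * log x ^ d := by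
          rw [h7, hA]
          ring
      _ ≤ (1 + η) * (x / H x) * (C * (B : ℝ) ^ (-(1 / 2) : ℝ)) * log x ^ d := by gcongr
      _ = C * (1 + η) * (B : ℝ) ^ (-(1 / 2) : ℝ) * (x / H x * log x ^ d) := by ring
      _ ≤ η * (x / H x * log x ^ d) := mul_le_mul_of_nonneg_right h3 (by positivity)
  have hBs : (B : ℝ) ^ s ≤ H x ^ s := rpow_le_rpow hB0.le hBH hs0.le
  have hT4 : ∑ b ∈ Icc 1 B, |Δ (x / b)| ≤ 1 / s * (lam * (V * H x ^ s)) := by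
    have h7 : ∀ b ∈ Icc 1 B, |Δ (x / b)| ≤ lam * V * (b : ℝ) ^ (s - 1) := by
      intro b hb'
      rw [Finset.mem_Icc] at hb'
      have hb1 : (1 : ℝ) ≤ b := by exact_mod_cast hb'.1
      have hbB : (b : ℝ) ≤ B := by exact_mod_cast hb'.2
      have hb0 : (0 : ℝ) < b := by linarith
      have h8 : 2 ≤ x / b := hA2.trans (div_le_div_of_nonneg_left hx0.le hb0 hbB)
      calc |Δ (x / b)| ≤ lam * (x / b) ^ (1 - s) * log (x / b) ^ e := hb _ h8
        _ ≤ lam * (x / b) ^ (1 - s) * log x ^ e := by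
          have : 0 ≤ log (x / b) := log_nonneg (by linarith)
          gcongr
          exact div_le_self hx0.le hb1
        _ = lam * V * (b : ℝ) ^ (s - 1) := by
          rw [hV, div_rpow hx0.le hb0.le, ← neg_sub 1 s, rpow_neg hb0.le]
          ring
    calc ∑ b ∈ Icc 1 B, |Δ (x / b)| ≤ ∑ b ∈ Icc 1 B, lam * V * (b : ℝ) ^ (s - 1) :=
          Finset.sum_le_sum h7
      _ = lam * V * ∑ b ∈ Icc 1 B, (b : ℝ) ^ (s - 1) := by rw [Finset.mul_sum]
      _ ≤ lam * V * (H x ^ s / s) := by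
        refine mul_le_mul_of_nonneg_left ((sum_rpow_sub_one_le hs0 hs1 B).trans ?_) (by positivity)
        gcongr
      _ = _ := by ring
  have hT5 : x * ∫ t in Set.Ioi A, |Δ t| / t ^ 2 ≤ (1 + η) / s * (lam * (V * H x ^ s)) := by
    have h7 : x * A ^ (-s) = x ^ (1 - s) * (B : ℝ) ^ s := by
      rw [hA, div_rpow hx0.le hB0.le, rpow_neg hB0.le, div_inv_eq_mul, ← mul_assoc,
        sub_eq_add_neg, rpow_add hx0, rpow_one]
    calc x * ∫ t in Set.Ioi A, |Δ t| / t ^ 2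
        ≤ x * ((1 + η) / s * (lam * log A ^ e * A ^ (-s))) :=
          mul_le_mul_of_nonneg_left (htail A hTA).2 hx0.le
      _ = (1 + η) / s * (lam * log A ^ e * (x * A ^ (-s))) := by ring
      _ = (1 + η) / s * (lam * log A ^ e * (x ^ (1 - s) * (B : ℝ) ^ s)) := by rw [h7]
      _ ≤ (1 + η) / s * (lam * log x ^ e * (x ^ (1 - s) * H x ^ s)) := by gcongr
      _ = _ := by
        rw [hV]
        ring
  refine (hmain x B hB1 hBx h6).trans ?_
  have hsum := add_le_add (add_le_add (add_le_add (add_le_add hT1 hT2) hT3) hT4) hT5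
  refine hsum.trans (le_of_eq ?_)
  ring

theorem tendsto_mul_rpow_mul_log_rpow_atTop {c a σ : ℝ} (hc : 0 < c) (ha : 0 < a) (hσ : 0 < σ) :
    Filter.Tendsto (fun x : ℝ => c * x ^ a * log x ^ σ) Filter.atTop Filter.atTop :=
  ((tendsto_rpow_atTop ha).const_mul_atTop hc).atTop_mul_atTop₀
    ((tendsto_rpow_atTop hσ).comp tendsto_log_atTop)

theorem tendsto_div_mul_rpow_mul_log_rpow_atTop {c a σ : ℝ} (hc : 0 < c) (ha : a < 1) :
    Filter.Tendsto (fun x : ℝ => x / (c * x ^ a * log x ^ σ)) Filter.atTop Filter.atTop := by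
  have h1 : Filter.Tendsto (fun x : ℝ => c * (log x ^ σ / x ^ (1 - a))) Filter.atTop
      (nhds (c * 0)) :=
    ((isLittleO_log_rpow_rpow_atTop σ (sub_pos.2 ha)).tendsto_div_nhds_zero).const_mul c
  rw [mul_zero] at h1
  have h2 : Filter.Tendsto (fun x : ℝ => c * (log x ^ σ / x ^ (1 - a))) Filter.atTop
      (nhdsWithin 0 (Set.Ioi 0)) := by
    refine tendsto_nhdsWithin_iff.2 ⟨h1, ?_⟩
    filter_upwards [Filter.eventually_gt_atTop 1] with x hx
    have := log_pos hx
    have : 0 < x := by linarith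
    simp only [Set.mem_Ioi]
    positivity
  refine h2.inv_tendsto_nhdsGT_zero.congr' ?_
  filter_upwards [Filter.eventually_gt_atTop 1] with x hx
  have hx0 : 0 < x := by linarith
  have := log_pos hx
  rw [Pi.inv_apply, rpow_sub hx0, rpow_one]
  have := rpow_pos_of_pos hx0 a
  field_simp

theorem hyperbola_constant_lt {D p : ℝ} (h : D = 1 ∧ p = 1 ∨ 2 ≤ D ∧ 0 < p ∧ p ≤ 1 / 2) :
    ((1 + 1 / (8 * (D + 2))) ^ 2 * p / 2 + 1 / (8 * (D + 2)))
      + (1 / (8 * (D + 2)) + (D + 1) + (1 + 1 / (8 * (D + 2))) * (D + 1))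
        * ((D + 1) / (2 * (D + 2)) * (p / (D + 1) + 1)) < p / (D + 1) + (D + 2) := by
  rcases h with ⟨rfl, rfl⟩ | ⟨hD, hp0, hp⟩
  · norm_num
  have hD0 : 0 < D + 2 := by linarith
  set η := 1 / (8 * (D + 2)) with hη
  have hη0 : 0 < η := by positivity
  have hη1 : η ≤ 1 / 32 := by
    rw [hη]
    exact one_div_le_one_div_of_le (by norm_num) (by linarith)
  have h1 : (η + (D + 1) + (1 + η) * (D + 1)) * ((D + 1) / (2 * (D + 2)) * (p / (D + 1) + 1))
      = (p + D + 1) * (1 - 15 / 16 / (D + 2)) := by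
    rw [hη]
    field_simp
    ring
  have h2 : 0 < (p + D + 1) * (15 / 16 / (D + 2)) := by positivity
  have h3 : 0 < p / (D + 1) := by positivity
  rw [h1]
  nlinarith [mul_le_mul hη1 hp hp0.le (by norm_num), mul_pos hη0 hp0]

theorem stmt_2 (k : ℕ) (hk : 3 ≤ k)
    (P : Polynomial ℝ) (hPdeg : P.natDegree ≤ k - 2)
    (hPlead : P.coeff (k - 2) = 1 / (Nat.factorial (k - 2) : ℝ))
    (lam : ℝ) (hlam : 0 < lam)
    (hInd : ∀ y : ℝ, 2 ≤ y →
      |Tk (k - 1) y - y * P.eval (Real.log y)|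
        ≤ lam * y ^ (((k : ℝ) - 2) / ((k : ℝ) - 1))
            * Real.log y ^ (((k : ℝ) - 2) * ((k : ℝ) - 3) / (2 * ((k : ℝ) - 1))))
    (c : ℝ)
    (hc : c = ((((k : ℝ) - 1) / (2 * k * lam))
        * (1 / (Nat.factorial (k - 1) : ℝ) + 1)) ^ (((k : ℝ) - 1) / k))
    (hc0 : 0 < c) (hc2 : c < 2) :
    ∃ (x₀ : ℝ) (Q : Polynomial ℝ), Real.exp 1 < x₀ ∧
      Q.natDegree ≤ k - 1 ∧ Q.coeff (k - 1) = 1 / (Nat.factorial (k - 1) : ℝ) ∧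
      ∀ x : ℝ, x₀ ≤ x →
        |Tk k x - x * Q.eval (Real.log x)|
          < ((1 / c) * (1 / (Nat.factorial (k - 1) : ℝ) + k)
                + (k : ℝ) ^ 3 * lam * c ^ (1 / ((k : ℝ) - 1))
                    / Real.log x₀ ^ (((k : ℝ) - 1) / k))
              * x ^ (((k : ℝ) - 1) / k)
              * Real.log x ^ (((k : ℝ) - 1) * ((k : ℝ) - 2) / (2 * k)) := by
  obtain ⟨d, rfl⟩ : ∃ d, k = d + 2 := ⟨k - 2, by omega⟩
  have hd : 1 ≤ d := by omega
  rw [Nat.add_sub_cancel] at hPdeg hPlead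
  rw [show d + 2 - 1 = d + 1 by omega] at hInd hc ⊢
  set D : ℝ := (d : ℝ) with hD
  have hD1 : 1 ≤ D := by rw [hD]; exact_mod_cast hd
  have hk0 : ((d + 2 : ℕ) : ℝ) = D + 2 := by push_cast; rfl
  rw [hk0] at hInd hc ⊢
  rw [show D + 2 - 1 = D + 1 by ring, show D + 2 - 2 = D by ring] at hInd ⊢
  rw [show D + 2 - 1 = D + 1 by ring] at hc
  rw [show D + 2 - 3 = D - 1 by ring] at hInd
  set p : ℝ := 1 / (Nat.factorial d : ℝ) with hp
  have hp0 : 0 < p := by positivity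
  have hf : 1 / (Nat.factorial (d + 1) : ℝ) = p / (D + 1) := by
    rw [Nat.factorial_succ, hp, hD]
    push_cast
    field_simp
  rw [hf] at hc ⊢
  set s : ℝ := 1 / (D + 1) with hs
  set σ : ℝ := D * (D + 3) / (2 * (D + 2)) with hσ
  have hD0 : 0 < D + 1 := by linarith
  have hs0 : 0 < s := by positivity
  have hs1 : s ≤ 1 := by
    rw [hs, div_le_one hD0]
    linarith
  have hs' : D / (D + 1) = 1 - s := by
    rw [hs]
    field_simp
    ring
  rw [hs'] at hInd
  set e : ℝ := D * (D - 1) / (2 * (D + 1)) with he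
  have he0 : 0 ≤ e := by
    have : 0 ≤ D - 1 := by linarith
    positivity
  have ha1 : 1 / (D + 2) < 1 := by
    rw [div_lt_one (by linarith)]
    linarith
  obtain ⟨Q, hQdeg, hQc, hQ⟩ := exists_eventually_abs_Tk_succ_sub_le (d + 1) d P hPdeg
    (by rw [hPlead]; exact hp0) hlam.le hs0 hs1 he0 hInd
    (tendsto_mul_rpow_mul_log_rpow_atTop hc0 (a := 1 / (D + 2)) (σ := σ)
      (by positivity) (by positivity))
    (tendsto_div_mul_rpow_mul_log_rpow_atTop hc0 ha1)
  rw [hPlead] at hQc hQ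
  have hcs : lam * c ^ s = 1 / c * ((D + 1) / (2 * (D + 2)) * (p / (D + 1) + 1)) := by
    have h1 : c * c ^ s = (D + 1) / (2 * (D + 2) * lam) * (p / (D + 1) + 1) := by
      have h2 : c * c ^ s = c ^ ((D + 2) / (D + 1)) := by
        rw [← rpow_one_add' hc0.le (by positivity)]
        congr 1
        rw [hs]
        field_simp
        ring
      rw [h2]
      conv_lhs => rw [hc]
      rw [← rpow_mul (by positivity), div_mul_div_cancel₀ (by positivity), div_self hD0.ne',
        rpow_one]
    have h3 : c ^ s = 1 / c * ((D + 1) / (2 * (D + 2) * lam) * (p / (D + 1) + 1)) := by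
      rw [← h1]
      field_simp
    rw [h3]
    field_simp
  have hnum := hyperbola_constant_lt (D := D) (p := p) (by
    rcases hd.eq_or_lt with h | h
    · left
      simp [hD, hp, ← h]
    · right
      have h2 : 2 ≤ D := by rw [hD]; exact_mod_cast h
      refine ⟨h2, hp0, one_div_le_one_div_of_le two_pos (h2.trans ?_)⟩
      rw [hD]
      exact_mod_cast Nat.self_le_factorial d)
  set η : ℝ := 1 / (8 * (D + 2)) with hη
  obtain ⟨X, hX⟩ := Filter.eventually_atTop.1 (hQ η (by positivity))
  refine ⟨max X (exp 1 + 1), Q, lt_max_of_lt_right (by linarith), hQdeg, hQc, fun x hx => ?_⟩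
  have he1 : 1 < exp 1 := by simp
  have hx1 : exp 1 + 1 ≤ x := (le_max_right _ _).trans hx
  have hx0 : 0 < x := by linarith
  have hL : 0 < log x := log_pos (by linarith)
  have hL₀ : 0 < log (max X (exp 1 + 1)) := log_pos (lt_max_of_lt_right (by linarith))
  set M : ℝ := x ^ ((D + 1) / (D + 2)) * log x ^ ((D + 1) * D / (2 * (D + 2))) with hM
  have hM0 : 0 < M := by positivity
  have hU : x / (c * x ^ (1 / (D + 2)) * log x ^ σ) * log x ^ d = 1 / c * M := by
    have h1 : x ^ ((D + 1) / (D + 2)) = x / x ^ (1 / (D + 2)) := by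
      rw [show (D + 1) / (D + 2) = 1 - 1 / (D + 2) by field_simp; ring, rpow_sub hx0, rpow_one]
    have h2 : log x ^ ((D + 1) * D / (2 * (D + 2))) = log x ^ d / log x ^ σ := by
      rw [← rpow_natCast, ← rpow_sub hL, hσ]
      congr 1
      field_simp
      ring
    rw [hM, h1, h2]
    field_simp
  have hV : x ^ (1 - s) * log x ^ e * (c * x ^ (1 / (D + 2)) * log x ^ σ) ^ s = c ^ s * M := by
    rw [mul_rpow (by positivity) (by positivity), mul_rpow hc0.le (by positivity),
      ← rpow_mul hx0.le, ← rpow_mul hL.le]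
    have h1 : x ^ ((D + 1) / (D + 2)) = x ^ (1 - s) * x ^ (1 / (D + 2) * s) := by
      rw [← rpow_add hx0]
      congr 1
      rw [hs]
      field_simp
      ring
    have h2 : log x ^ ((D + 1) * D / (2 * (D + 2))) = log x ^ e * log x ^ (σ * s) := by
      rw [← rpow_add hL]
      congr 1
      rw [hs, he, hσ]
      field_simp
      ring
    rw [hM, h1, h2]
    ring
  have hxX := hX x ((le_max_left _ _).trans hx)
  rw [hU, hV] at hxX
  have hcM : 0 < 1 / c * M := by positivity
  have hextra : 0 < (D + 2) ^ 3 * lam * c ^ s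
      / log (max X (exp 1 + 1)) ^ ((D + 1) / (D + 2)) * M := by positivity
  have hinv : 1 / s = D + 1 := by rw [hs, one_div_one_div]
  have hinv' : (1 + η) / s = (1 + η) * (D + 1) := by rw [← hinv]; ring
  rw [hinv, hinv'] at hxX
  refine hxX.trans_lt ?_
  calc _ = (((1 + η) ^ 2 * p / 2 + η) + (η + (D + 1) + (1 + η) * (D + 1))
          * ((D + 1) / (2 * (D + 2)) * (p / (D + 1) + 1))) * (1 / c * M) := by
        linear_combination (η + (D + 1) + (1 + η) * (D + 1)) * M * hcs
    _ < (p / (D + 1) + (D + 2)) * (1 / c * M) := mul_lt_mul_of_pos_right hnum hcM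
    _ < (p / (D + 1) + (D + 2)) * (1 / c * M) + (D + 2) ^ 3 * lam * c ^ s
          / log (max X (exp 1 + 1)) ^ ((D + 1) / (D + 2)) * M := by linarith
    _ = _ := by
        rw [hM]
        ring
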